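/- Let k ≥ 3 and let u_k be the pattern 2 1 (k+1) k (k−1) ⋯ 4 3 of length k+1 (i.e. u_k(1) = 2, u_k(2) = 1 and u_k(j) = k+4−j for 3 ≤ j ≤ k+1). Let a_n be the number of permutations of {1,…,n} avoiding 123, 3214 and u_k. Then in the ring of formal power series over ℤ, (∑_{n≥0} a_n x^n)·(1 − 3x + x^2 + x^k) = 1 − 2x + x^k; that is, the generating function of (a_n) is (1−2x+x^k)/(1−3x+x^2+x^k). -/

import Mathlib

/-- A permutation `σ` of `{1,…,n}` contains the pattern `τ` (given in one-line
notation as a function `Fin k → ℕ`) if there is a strictly increasing choice of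
indices along which `σ` is order-isomorphic to `τ`. -/
def Contains {n k : ℕ} (σ : Equiv.Perm (Fin n)) (τ : Fin k → ℕ) : Prop :=
  ∃ f : Fin k → Fin n, StrictMono f ∧ ∀ a b : Fin k, σ (f a) < σ (f b) ↔ τ a < τ b

/-- `σ` avoids the pattern `τ`. -/
def Avoids {n k : ℕ} (σ : Equiv.Perm (Fin n)) (τ : Fin k → ℕ) : Prop :=
  ¬ Contains σ τ

def p123 : Fin 3 → ℕ := ![1, 2, 3]
def p132 : Fin 3 → ℕ := ![1, 3, 2]
def p213 : Fin 3 → ℕ := ![2, 1, 3]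
def p1432 : Fin 4 → ℕ := ![1, 4, 3, 2]
def p3214 : Fin 4 → ℕ := ![3, 2, 1, 4]
def p2143 : Fin 4 → ℕ := ![2, 1, 4, 3]

/-- The pattern `q_k = 1 (k+1) k (k-1) ⋯ 2` of length `k+1` (one-line notation,
position `j` is 0-indexed here, values 1-indexed). -/
def qpat (k : ℕ) : Fin (k + 1) → ℕ := fun j => if j.val = 0 then 1 else k + 2 - j.val

/-- The pattern `r_k = k (k-1) ⋯ 2 1 (k+1)` of length `k+1`. -/
def rpat (k : ℕ) : Fin (k + 1) → ℕ := fun j => if j.val = k then k + 1 else k - j.val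

/-- The pattern `s_k = (k-1)(k-2) ⋯ 2 1 (k+1) k` of length `k+1`. -/
def spat (k : ℕ) : Fin (k + 1) → ℕ := fun j =>
  if j.val = k - 1 then k + 1 else if j.val = k then k else k - 1 - j.val

/-- The pattern `u_k = 2 1 (k+1) k (k-1) ⋯ 4 3` of length `k+1`. -/
def upat (k : ℕ) : Fin (k + 1) → ℕ := fun j =>
  if j.val = 0 then 2 else if j.val = 1 then 1 else k + 3 - j.val

open Finset

/-- Insert the maximum at position `p`. -/
def ins {n : ℕ} (p : Fin (n + 1)) (τ : Equiv.Perm (Fin n)) : Equiv.Perm (Fin (n + 1)) :=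
  (finSuccEquiv' p).trans ((Equiv.optionCongr τ).trans (finSuccEquiv' (Fin.last n)).symm)

theorem ins_self {n : ℕ} (p : Fin (n + 1)) (τ : Equiv.Perm (Fin n)) : ins p τ p = Fin.last n := by
  simp [ins]

theorem ins_succAbove {n : ℕ} (p : Fin (n + 1)) (τ : Equiv.Perm (Fin n)) (i : Fin n) :
    ins p τ (p.succAbove i) = (τ i).castSucc := by
  simp [ins]

theorem ins_inj {n : ℕ} : Function.Injective
    (fun x : Fin (n + 1) × Equiv.Perm (Fin n) => ins x.1 x.2) := by
  rintro ⟨p, τ⟩ ⟨q, ρ⟩ h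
  simp only at h
  have hpq : p = q := by
    apply (ins p τ).injective
    rw [ins_self, h, ins_self]
  subst hpq
  have : τ = ρ := by
    ext i
    have := ins_succAbove p τ i
    rw [h, ins_succAbove] at this
    simpa using (congrArg Fin.val this).symm
  rw [this]

theorem ins_bij {n : ℕ} : Function.Bijective
    (fun x : Fin (n + 1) × Equiv.Perm (Fin n) => ins x.1 x.2) := by
  rw [Fintype.bijective_iff_injective_and_card]
  refine ⟨ins_inj, ?_⟩
  simp [Fintype.card_perm, Nat.factorial_succ]

open Classical in
/-- Number of permutations with a property. -/
noncomputable def cnt {n : ℕ} (Q : Equiv.Perm (Fin n) → Prop) : ℕ := (univ.filter Q).card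

theorem cnt_zero {n : ℕ} (Q : Equiv.Perm (Fin n) → Prop) (h : ∀ σ, ¬ Q σ) : cnt Q = 0 := by
  classical
  unfold cnt
  rw [Finset.card_eq_zero, Finset.filter_eq_empty_iff]
  intro σ _
  exact h σ

theorem card_split {n : ℕ} (Q : Equiv.Perm (Fin (n + 1)) → Prop) :
    cnt Q = ∑ p : Fin (n + 1), cnt fun τ => Q (ins p τ) := by
  classical
  simp only [cnt, Finset.card_filter]
  rw [← Fintype.sum_prod_type' (f := fun p τ => if Q (ins p τ) then 1 else 0)]
  symm
  exact Function.Bijective.sum_comp ins_bij (fun σ => if Q σ then 1 else 0)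

theorem contains_ins {n k : ℕ} (p : Fin (n + 1)) (τ : Equiv.Perm (Fin n)) (t : Fin k → ℕ)
    (h : Contains τ t) : Contains (ins p τ) t := by
  obtain ⟨f, hf, h⟩ := h
  refine ⟨fun a => p.succAbove (f a), fun a b hab => Fin.strictMono_succAbove p (hf hab), ?_⟩
  intro a b
  rw [ins_succAbove, ins_succAbove, Fin.castSucc_lt_castSucc_iff]
  exact h a b

theorem contains_ins_cases {n k : ℕ} (p : Fin (n + 1)) (τ : Equiv.Perm (Fin n)) (t : Fin k → ℕ)
    (h : Contains (ins p τ) t) : Contains τ t ∨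
      ∃ f : Fin k → Fin (n + 1), StrictMono f ∧
        (∀ a b : Fin k, ins p τ (f a) < ins p τ (f b) ↔ t a < t b) ∧
        ∃ a, f a = p ∧ ∀ b, b ≠ a → t b < t a := by
  obtain ⟨f, hf, h⟩ := h
  by_cases hp : ∃ a, f a = p
  · right
    obtain ⟨a, ha⟩ := hp
    refine ⟨f, hf, h, a, ha, fun b hb => ?_⟩
    rw [← h, ha, ins_self]
    rw [Fin.lt_last_iff_ne_last, ← ins_self p τ]
    intro h2
    exact hb (hf.injective (((ins p τ).injective h2).trans ha.symm))
  · left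
    push Not at hp
    have : ∀ a, ∃ g, p.succAbove g = f a := fun a => Fin.exists_succAbove_eq (hp a)
    choose g hg using this
    refine ⟨g, fun a b hab => ?_, fun a b => ?_⟩
    · have := hf hab
      rw [← hg, ← hg] at this
      exact (Fin.strictMono_succAbove p).lt_iff_lt.1 this
    · rw [← h, ← hg, ← hg, ins_succAbove, ins_succAbove, Fin.castSucc_lt_castSucc_iff]

/-- The class. -/
def Av (k : ℕ) {n : ℕ} (σ : Equiv.Perm (Fin n)) : Prop :=
  Avoids σ p123 ∧ Avoids σ p3214 ∧ Avoids σ (upat k)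

theorem Av.of_ins {k n : ℕ} {p : Fin (n + 1)} {τ : Equiv.Perm (Fin n)} (h : Av k (ins p τ)) :
    Av k τ :=
  ⟨fun c => h.1 (contains_ins p τ _ c), fun c => h.2.1 (contains_ins p τ _ c),
    fun c => h.2.2 (contains_ins p τ _ c)⟩

theorem contains123_of {n : ℕ} (σ : Equiv.Perm (Fin n)) (i j l : Fin n) (h1 : i < j) (h2 : j < l)
    (h3 : σ i < σ j) (h4 : σ j < σ l) : Contains σ p123 := by
  refine ⟨![i, j, l], ?_, ?_⟩
  · intro a b hab
    fin_cases a <;> fin_cases b <;> simp at hab ⊢ <;> first | assumption | exact h1.trans h2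
  · intro a b
    have := h3.trans h4
    fin_cases a <;> fin_cases b <;> simp [p123] <;> order

theorem contains3214_of {n : ℕ} (σ : Equiv.Perm (Fin n)) (i j l m : Fin n) (h1 : i < j)
    (h2 : j < l) (h3 : l < m)
    (h4 : σ j < σ i) (h5 : σ l < σ j) (h6 : σ i < σ m) : Contains σ p3214 := by
  refine ⟨![i, j, l, m], ?_, ?_⟩
  · intro a b hab
    fin_cases a <;> fin_cases b <;> simp at hab ⊢ <;> order
  · intro a b
    fin_cases a <;> fin_cases b <;> simp [p3214] <;> order

theorem max123 {n : ℕ} {p : Fin n} {f : Fin 3 → Fin n} (hf : StrictMono f) {a : Fin 3}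
    (hp : f a = p) (ha : ∀ b, b ≠ a → p123 b < p123 a) : a = 2 := by
  by_contra h
  have h2 := ha 2 (Ne.symm h)
  clear ha hp
  revert a
  decide

theorem max3214 {a : Fin 4} (ha : ∀ b, b ≠ a → p3214 b < p3214 a) : a = 3 := by
  by_contra h
  have h2 := ha 3 (Ne.symm h)
  clear ha
  revert a
  decide

theorem maxu {k : ℕ} (hk : 3 ≤ k) {a : Fin (k + 1)} (ha : ∀ b, b ≠ a → upat k b < upat k a) :
    a.val = 2 := by
  by_contra h
  have := ha ⟨2, by omega⟩ (by intro h2; apply h; rw [← h2])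
  simp only [upat] at this
  split_ifs at this <;> omega

theorem strictMono_val_le {n k : ℕ} {f : Fin k → Fin n} (hf : StrictMono f) (a : Fin k) :
    a.val ≤ (f a).val := by
  obtain ⟨a, ha⟩ := a
  induction a with
  | zero => simp
  | succ a ih =>
    have h1 := ih (by omega)
    have h2 : f ⟨a, by omega⟩ < f ⟨a + 1, ha⟩ := hf (by simp)
    simp only [Fin.lt_def] at h1 h2 ⊢
    omega

theorem av_ins_small {k n : ℕ} (hk : 3 ≤ k) (p : Fin (n + 1)) (hp : p.val < 2)
    (τ : Equiv.Perm (Fin n)) : Av k (ins p τ) ↔ Av k τ := by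
  refine ⟨Av.of_ins, fun h => ⟨fun c => ?_, fun c => ?_, fun c => ?_⟩⟩
  · rcases contains_ins_cases _ _ _ c with c | ⟨f, hf, -, a, h1, h2⟩
    · exact h.1 c
    · have h3 := max123 hf h1 h2
      have := strictMono_val_le hf a
      rw [h1, h3] at this
      simp at this; omega
  · rcases contains_ins_cases _ _ _ c with c | ⟨f, hf, -, a, h1, h2⟩
    · exact h.2.1 c
    · have h3 := max3214 h2
      have := strictMono_val_le hf a
      rw [h1, h3] at this
      simp at this; omega
  · rcases contains_ins_cases _ _ _ c with c | ⟨f, hf, -, a, h1, h2⟩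
    · exact h.2.2 c
    · have h3 := maxu hk h2
      have := strictMono_val_le hf a
      rw [h1, h3] at this
      omega

theorem ins_lt_last {n : ℕ} (p : Fin (n + 1)) (τ : Equiv.Perm (Fin n)) (i : Fin (n + 1))
    (h : i ≠ p) : ins p τ i < ins p τ p := by
  rw [ins_self, Fin.lt_last_iff_ne_last, ← ins_self p τ]
  exact fun h2 => h ((ins p τ).injective h2)

theorem not_av_ins_large {k n : ℕ} (p : Fin (n + 1)) (hp : 3 ≤ p.val)
    (τ : Equiv.Perm (Fin n)) : ¬ Av k (ins p τ) := by
  intro h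
  have hn := p.2
  set i : Fin (n + 1) := ⟨0, by omega⟩ with hi
  set j : Fin (n + 1) := ⟨1, by omega⟩ with hj
  set l : Fin (n + 1) := ⟨2, by omega⟩ with hl
  have hij : i < j := by rw [Fin.lt_def]; simp only [hi, hj]; omega
  have hjl : j < l := by rw [Fin.lt_def]; simp only [hj, hl]; omega
  have hlp : l < p := by rw [Fin.lt_def]; simp only [hl]; omega
  have h1 := ins_lt_last p τ i (by order)
  have h2 := ins_lt_last p τ j (by order)
  have h3 := ins_lt_last p τ l (by order)
  have n1 : ins p τ i ≠ ins p τ j := fun e => hij.ne ((ins p τ).injective e)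
  have n2 : ins p τ j ≠ ins p τ l := fun e => hjl.ne ((ins p τ).injective e)
  by_cases c1 : ins p τ i < ins p τ j
  · exact h.1 (contains123_of _ i j p hij (by order) c1 h2)
  by_cases c2 : ins p τ j < ins p τ l
  · exact h.1 (contains123_of _ j l p hjl (by order) c2 h3)
  exact h.2.1 (contains3214_of _ i j l p hij hjl hlp (by order) (by order) h1)

theorem succAbove_zero' {n : ℕ} (p : Fin (n + 3)) (hp : p.val = 2) :
    p.succAbove (0 : Fin (n + 2)) = 0 := by
  rw [Fin.succAbove_of_castSucc_lt _ _ (by rw [Fin.lt_def]; simp [hp])]; rfl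

theorem succAbove_one' {n : ℕ} (p : Fin (n + 3)) (hp : p.val = 2) :
    p.succAbove (1 : Fin (n + 2)) = 1 := by
  rw [Fin.succAbove_of_castSucc_lt _ _ (by rw [Fin.lt_def]; simp [hp])]; rfl

theorem ins_zero' {n : ℕ} (p : Fin (n + 3)) (hp : p.val = 2) (τ : Equiv.Perm (Fin (n + 2))) :
    ins p τ 0 = (τ 0).castSucc := by
  rw [← ins_succAbove p τ, succAbove_zero' p hp]

theorem ins_one' {n : ℕ} (p : Fin (n + 3)) (hp : p.val = 2) (τ : Equiv.Perm (Fin (n + 2))) :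
    ins p τ 1 = (τ 1).castSucc := by
  rw [← ins_succAbove p τ, succAbove_one' p hp]

theorem card_gt {n : ℕ} (σ : Equiv.Perm (Fin n)) (i : Fin n) :
    (univ.filter fun x => σ i < σ x).card + (σ i).val + 1 = n := by
  have : (univ.filter fun x => σ i < σ x).card = (Finset.Ioi (σ i)).card := by
    apply Finset.card_bij (fun x _ => σ x)
    · intro x hx; simpa using hx
    · intro x _ y _ h; exact σ.injective h
    · intro y hy; exact ⟨σ.symm y, by simpa using hy, by simp⟩
  rw [this, Fin.card_Ioi]
  have := (σ i).2
  omega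

theorem av_ins_two {k n : ℕ} (hk : 3 ≤ k) (p : Fin (n + 3)) (hp : p.val = 2)
    (τ : Equiv.Perm (Fin (n + 2))) : Av k (ins p τ) ↔
      (Av k τ ∧ τ 1 < τ 0 ∧ n + 1 < (k - 2) + (τ 0).val) := by
  have e0 := ins_zero' p hp τ
  have e1 := ins_one' p hp τ
  have h01 : (0 : Fin (n + 3)) < 1 := by simp
  have h1p : (1 : Fin (n + 3)) < p := by rw [Fin.lt_def, hp]; simp
  have l0 := ins_lt_last p τ 0 (by order)
  have l1 := ins_lt_last p τ 1 (by order)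
  have hg := card_gt (ins p τ) 0
  constructor
  · intro h
    have hd : ins p τ 1 < ins p τ 0 := by
      by_contra hc
      have hne : ins p τ 0 ≠ ins p τ 1 := fun e => h01.ne ((ins p τ).injective e)
      exact h.1 (contains123_of _ 0 1 p h01 h1p (by order) l1)
    refine ⟨h.of_ins, ?_, ?_⟩
    · rwa [e0, e1, Fin.castSucc_lt_castSucc_iff] at hd
    · by_contra hc
      have hv : (ins p τ 0).val = (τ 0).val := by rw [e0]; rfl
      have hcard : k - 1 ≤ (univ.filter fun x => ins p τ 0 < ins p τ x).card := by omega
      set S := univ.filter fun x => ins p τ 0 < ins p τ x with hS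
      let g := S.orderEmbOfCardLe hcard
      have hgS : ∀ x, ins p τ 0 < ins p τ (g x) := fun x => by
        have := S.orderEmbOfCardLe_mem hcard x
        exact (Finset.mem_filter.1 this).2
      have hgpos : ∀ x, 2 ≤ (g x).val := fun x => by
        by_contra hlt
        have : g x = 0 ∨ g x = 1 := by
          rcases Nat.lt_or_ge (g x).val 1 with h | h
          · left; ext; simp; omega
          · right; ext; simp; omega
        have h2 := hgS x
        rcases this with e | e <;> rw [e] at h2 <;> order
      have hganti : ∀ x y, x < y → ins p τ (g y) < ins p τ (g x) := fun x y hxy => by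
        by_contra hlt
        have hlt2 : g x < g y := g.strictMono hxy
        have hne : ins p τ (g x) ≠ ins p τ (g y) := fun e => hlt2.ne ((ins p τ).injective e)
        refine h.1 (contains123_of _ 0 (g x) (g y) ?_ hlt2 (hgS x) (by order))
        rw [Fin.lt_def]; have := hgpos x; simp; omega
      have hgiff : ∀ x y, ins p τ (g x) < ins p τ (g y) ↔ y < x := fun x y => by
        constructor
        · intro h
          by_contra hc
          rcases (not_lt.1 hc).lt_or_eq with h2 | h2
          · exact absurd (hganti _ _ h2) (by order)
          · rw [h2] at h; exact lt_irrefl _ h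
        · exact hganti _ _
      apply h.2.2
      refine ⟨fun a => if a.val = 0 then 0 else if a.val = 1 then 1 else
        g ⟨a.val - 2, by omega⟩, ?_, ?_⟩
      · intro a b hab
        rw [Fin.lt_def] at hab
        simp only
        split_ifs with c1 c2 c3 c4 c5 c6 <;> try omega
        all_goals first
          | exact h01
          | (apply g.strictMono
             rw [Fin.lt_def]; simp only; omega)
          | (have := hgpos ⟨b.val - 2, by omega⟩
             rw [Fin.lt_def]; simp; omega)
      · intro a b
        have ha := a.2
        have hb := b.2
        simp only [upat]
        split_ifs with c1 c2 c3 c4 c5 c6 c7 c8 <;>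
          first
          | (simp; done)
          | (rw [hgiff, Fin.lt_def]; simp only; omega)
          | (have q1 := hgS ⟨b.val - 2, by omega⟩
             constructor <;> intro <;> first | omega | order)
          | (have q1 := hgS ⟨a.val - 2, by omega⟩
             constructor <;> intro <;> first | omega | order)
          | (constructor <;> intro <;> first | omega | order)
  · rintro ⟨h, hd, hm⟩
    have hd' : ins p τ 1 < ins p τ 0 := by
      rwa [e0, e1, Fin.castSucc_lt_castSucc_iff]
    have small : ∀ x y : Fin (n + 3), x < y → y < p → x = 0 ∧ y = 1 := by
      intro x y h1 h2
      rw [Fin.lt_def] at h1 h2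
      constructor <;> ext <;> simp <;> omega
    refine ⟨fun c => ?_, fun c => ?_, fun c => ?_⟩
    · rcases contains_ins_cases _ _ _ c with c | ⟨f, hf, h0, a, h1, h2⟩
      · exact h.1 c
      · have h3 := max123 hf h1 h2
        subst h3
        obtain ⟨s1, s2⟩ := small (f 0) (f 1) (hf (by decide)) (by rw [← h1]; exact hf (by decide))
        have := (h0 0 1).2 (by simp [p123])
        rw [s1, s2] at this
        order
    · rcases contains_ins_cases _ _ _ c with c | ⟨f, hf, -, a, h1, h2⟩
      · exact h.2.1 c
      · have h3 := max3214 h2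
        have := strictMono_val_le hf a
        rw [h1, h3] at this
        simp at this; omega
    · rcases contains_ins_cases _ _ _ c with c | ⟨f, hf, h0, a, h1, h2⟩
      · exact h.2.2 c
      · have h3 := maxu hk h2
        obtain ⟨s1, s2⟩ := small (f ⟨0, by omega⟩) (f ⟨1, by omega⟩)
          (hf (by rw [Fin.lt_def]; simp))
          (by rw [← h1]; apply hf; rw [Fin.lt_def]; simp only; omega)
        have hle : (univ : Finset (Fin (k - 1))).card ≤
            (univ.filter fun x => ins p τ 0 < ins p τ x).card := by
          apply Finset.card_le_card_of_injOn (fun i => f ⟨i.val + 2, by omega⟩)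
          · intro i _
            simp only [coe_filter, mem_univ, true_and, Set.mem_ofPred_eq]
            rw [← s1, h0]
            simp only [upat]
            have := i.2
            simp
            omega
          · intro i _ j _ hij
            have := hf.injective hij
            simp at this
            ext; exact this
        have hv : (ins p τ 0).val = (τ 0).val := by rw [e0]; rfl
        simp at hle
        omega

/-- Number of permutations in the class. -/
noncomputable def av (k n : ℕ) : ℕ := cnt fun σ : Equiv.Perm (Fin n) => Av k σ

/-- Number with initial descent and few entries above the first. -/
noncomputable def pv (k M n : ℕ) : ℕ := cnt fun σ : Equiv.Perm (Fin (n + 2)) =>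
  Av k σ ∧ σ 1 < σ 0 ∧ n + 1 < M + (σ 0).val

theorem av_zero (k : ℕ) : av k 0 = 1 := by
  classical
  unfold av cnt
  rw [Finset.filter_true_of_mem]
  · simp
  · intro σ _
    refine ⟨?_, ?_, ?_⟩ <;> rintro ⟨f, -⟩ <;> exact (f 0).elim0

theorem av_one {k : ℕ} (hk : 3 ≤ k) : av k 1 = 1 := by
  have h : av k 1 = av k 0 := by
    unfold av
    rw [card_split (n := 0), Fin.sum_univ_one]
    simp only [av_ins_small hk _ (show (0 : Fin 1).val < 2 by simp)]
  rw [h, av_zero]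

theorem av_two {k : ℕ} (hk : 3 ≤ k) : av k 2 = 2 := by
  have : av k 2 = 2 * av k 1 := by
    unfold av
    rw [card_split (n := 1), Fin.sum_univ_two]
    simp only [av_ins_small hk _ (show (0 : Fin 2).val < 2 by simp),
      av_ins_small hk _ (show (1 : Fin 2).val < 2 by simp)]
    ring
  rw [this, av_one hk]

theorem av_rec {k : ℕ} (hk : 3 ≤ k) (n : ℕ) :
    av k (n + 3) = 2 * av k (n + 2) + pv k (k - 2) n := by
  unfold av pv
  rw [card_split, Fin.sum_univ_succ, Fin.sum_univ_succ, Fin.sum_univ_succ]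
  simp only [av_ins_small hk _ (show (0 : Fin (n + 3)).val < 2 by simp),
    av_ins_small hk _ (show (Fin.succ (0 : Fin (n + 2))).val < 2 by simp),
    av_ins_two hk _ (show (Fin.succ (Fin.succ (0 : Fin (n + 1)))).val = 2 by simp)]
  rw [Finset.sum_eq_zero]
  · ring
  · intro i _
    apply cnt_zero
    intro τ
    exact not_av_ins_large _ (by simp) τ

theorem pv_zero {k : ℕ} (n : ℕ) : pv k 0 n = 0 := by
  unfold pv
  apply cnt_zero
  rintro σ ⟨-, -, h⟩
  have := (σ 0).2
  omega

theorem q_zero {k : ℕ} (hk : 3 ≤ k) (M n : ℕ) (τ : Equiv.Perm (Fin (n + 1))) :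
    (Av k (ins 0 τ) ∧ ins 0 τ 1 < ins 0 τ 0 ∧ n + 1 < M + 1 + (ins 0 τ 0).val) ↔ Av k τ := by
  rw [av_ins_small hk _ (by simp)]
  have := ins_lt_last 0 τ 1 (by simp)
  rw [ins_self] at this ⊢
  simp [this]

theorem q_one {k : ℕ} (M n : ℕ) (τ : Equiv.Perm (Fin (n + 1))) :
    ¬ (Av k (ins (Fin.succ 0) τ) ∧ ins (Fin.succ 0) τ 1 < ins (Fin.succ 0) τ 0 ∧
      n + 1 < M + 1 + (ins (Fin.succ 0) τ 0).val) := by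
  have := ins_lt_last 1 τ 0 (by simp)
  rintro ⟨-, h, -⟩
  simp only [Fin.succ_zero_eq_one] at h
  order

theorem pv_one {k : ℕ} (hk : 3 ≤ k) (M : ℕ) : pv k (M + 1) 0 = av k 1 := by
  unfold pv av
  rw [card_split, Fin.sum_univ_succ, Fin.sum_univ_one]
  simp only [q_zero hk, q_one, cnt_zero (fun _ => False) (fun _ h => h), add_zero]

theorem pv_rec {k : ℕ} (hk : 3 ≤ k) (M : ℕ) (hM : M ≤ k - 2) (n : ℕ) :
    pv k (M + 1) (n + 1) = av k (n + 2) + pv k M n := by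
  unfold pv av
  rw [card_split, Fin.sum_univ_succ, Fin.sum_univ_succ, Fin.sum_univ_succ]
  simp only [q_zero hk, q_one, cnt_zero (fun _ => False) (fun _ h => h)]
  rw [Finset.sum_eq_zero]
  · have h2 : (Fin.succ (Fin.succ (0 : Fin (n + 1)))).val = 2 := by simp
    simp only [av_ins_two hk _ h2, ins_zero' _ h2, ins_one' _ h2]
    rw [zero_add, add_zero]
    congr 2
    ext τ
    simp only [Fin.castSucc_lt_castSucc_iff, Fin.val_castSucc]
    constructor
    · rintro ⟨⟨a, b, c⟩, d, e⟩
      exact ⟨a, b, by omega⟩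
    · rintro ⟨a, b, c⟩
      exact ⟨⟨a, b, by omega⟩, b, by omega⟩
  · intro i _
    apply cnt_zero
    intro τ h
    exact not_av_ins_large _ (by simp) τ h.1

/-- Difference form. -/
theorem pv_diff {k : ℕ} (hk : 3 ≤ k) (M : ℕ) (hM : M + 1 ≤ k - 2) (n : ℕ) :
    pv k (M + 1) (n + 1) + (if M + 1 ≤ n + 1 then av k (n + 1 - M) else 0) =
      av k (n + 2) + pv k (M + 1) n := by
  induction M generalizing n with
  | zero =>
    rw [pv_rec hk 0 (by omega), pv_zero]
    rcases n with _ | n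
    · rw [pv_one hk]; simp
    · rw [pv_rec hk 0 (by omega), pv_zero]; simp
  | succ M ih =>
    rw [pv_rec hk (M + 1) (by omega)]
    rcases n with _ | n
    · rw [pv_one hk, pv_one hk]; simp
    · rw [pv_rec hk (M + 1) (by omega)]
      have := ih (by omega) n
      simp only [Nat.add_sub_add_right, Nat.add_le_add_iff_right] at this ⊢
      omega

theorem pv_small {k : ℕ} (hk : 3 ≤ k) : pv k (k - 2) 0 = 1 := by
  obtain ⟨M, hM⟩ : ∃ M, k - 2 = M + 1 := ⟨k - 3, by omega⟩
  rw [hM, pv_one hk, av_one hk]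

theorem av_main {k : ℕ} (hk : 3 ≤ k) (n : ℕ) :
    (av k (n + 3) : ℤ) = 3 * av k (n + 2) - av k (n + 1)
      - (if k ≤ n + 3 then (av k (n + 3 - k) : ℤ) else 0) + (if n + 3 = k then 1 else 0) := by
  rcases n with _ | n
  · rw [av_rec hk, pv_small hk, av_two hk, av_one hk]
    by_cases h : k = 3
    · subst h; simp [av_zero]
    · rw [if_neg (by omega), if_neg (by omega)]; simp
  · obtain ⟨M, hM⟩ : ∃ M, k = M + 3 := ⟨k - 3, by omega⟩
    have h1 := av_rec hk (n + 1)
    have h2 := av_rec hk n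
    have h3 := pv_diff hk M (by omega) n
    have h4 : k - 2 = M + 1 := by omega
    rw [h4] at h1 h2
    have h5 : n + 1 + 3 - k = n + 1 - M := by omega
    rw [h5]
    have h0 := av_zero k
    have e1 : n + 1 + 2 = n + 3 := rfl
    have e2 : n + 1 + 1 = n + 2 := rfl
    rw [e1] at h1 ⊢
    rw [e2]
    by_cases c : M + 1 ≤ n + 1
    · rw [if_pos c] at h3
      rw [if_pos (by omega), if_neg (by omega)]
      omega
    · rw [if_neg c] at h3
      by_cases c2 : M = n + 1
      · rw [if_pos (by omega), if_pos (by omega)]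
        have : n + 1 - M = 0 := by omega
        rw [this, h0]
        omega
      · rw [if_neg (by omega), if_neg (by omega)]
        omega

theorem card_eq_av (k n : ℕ) : Nat.card {σ : Equiv.Perm (Fin n) //
    Avoids σ p123 ∧ Avoids σ p3214 ∧ Avoids σ (upat k)} = av k n := by
  classical
  rw [Nat.card_eq_fintype_card, Fintype.card_subtype]
  unfold av Av cnt
  congr

theorem stmt18 (k : ℕ) (hk : 3 ≤ k) :
    (PowerSeries.mk fun n => ((Nat.card {σ : Equiv.Perm (Fin n) //
        Avoids σ p123 ∧ Avoids σ p3214 ∧ Avoids σ (upat k)} : ℕ) : ℤ)) *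
      (1 - 3 * PowerSeries.X + PowerSeries.X ^ 2 + PowerSeries.X ^ k) =
      1 - 2 * PowerSeries.X + PowerSeries.X ^ k := by
  simp only [card_eq_av]
  have c3 : (3 : PowerSeries ℤ) = PowerSeries.C 3 := by simp
  have c2 : (2 : PowerSeries ℤ) = PowerSeries.C 2 := by simp
  have e : (PowerSeries.mk fun n => (av k n : ℤ)) *
      (1 - 3 * PowerSeries.X + PowerSeries.X ^ 2 + PowerSeries.X ^ k) =
      (PowerSeries.mk fun n => (av k n : ℤ))
        - PowerSeries.C 3 * ((PowerSeries.mk fun n => (av k n : ℤ)) * PowerSeries.X ^ 1)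
        + (PowerSeries.mk fun n => (av k n : ℤ)) * PowerSeries.X ^ 2
        + (PowerSeries.mk fun n => (av k n : ℤ)) * PowerSeries.X ^ k := by
    rw [← c3]; ring
  have e2 : (1 - 2 * PowerSeries.X + PowerSeries.X ^ k : PowerSeries ℤ) =
      1 - PowerSeries.C 2 * PowerSeries.X ^ 1 + PowerSeries.X ^ k := by
    rw [← c2]; ring
  rw [e, e2]
  clear e e2 c2 c3
  ext n
  simp only [map_add, map_sub, PowerSeries.coeff_C_mul]
  simp only [PowerSeries.coeff_mul_X_pow', PowerSeries.coeff_mk, PowerSeries.coeff_X_pow, PowerSeries.coeff_one, one_mul]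
  rcases n with _ | _ | _ | n
  · have := av_zero k
    simp [this, show ¬ k = 0 by omega, show ¬ 0 = k by omega]
  · have := av_zero k
    have := av_one hk
    simp [*, show ¬ k ≤ 1 by omega, show ¬ 1 = k by omega]
  · have := av_zero k
    have := av_one hk
    have := av_two hk
    simp [*, show ¬ k ≤ 2 by omega, show ¬ 2 = k by omega]
  · have := av_main hk n
    simp only [show n + 1 + 1 + 1 = n + 3 from rfl]
    rw [this]
    simp [show n + 3 - 2 = n + 1 by omega, show n + 3 - 1 = n + 2 by omega]
    ring
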